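/- arXiv:1705.08657 — 2 statements merged into one kernel-verified Lean document; each statement's English description precedes it below -/
import Mathlib

section
/- Let A ∈ ℤ^{m×n}, b ∈ ℤ^m, l, u ∈ ℤ^n with l ≤ u, and let f : ℤ^n → ℤ be separable convex. Let x be feasible for (IP)_{A,b,l,u,f}. If for every g ∈ 𝒢(A) and every α ∈ ℤ with l ≤ x + αg ≤ u it holds that f(x + αg) ≥ f(x), then x is an optimal solution, i.e. f(x) ≤ f(y) for every feasible y. -/
/-- Two integer vectors are sign-compatible if they lie in the same orthant. -/
def SignCompat {ι : Type*} (x y : ι → ℤ) : Prop := ∀ i, 0 ≤ x i * y i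

/-- The conformal order: `y ⊑ x` iff `y` and `x` are sign-compatible and
`|y i| ≤ |x i|` for every coordinate. -/
def Conforms {ι : Type*} (y x : ι → ℤ) : Prop :=
  SignCompat y x ∧ ∀ i, |y i| ≤ |x i|

/-- The Graver basis of an integer matrix `A`: the set of `⊑`-minimal nonzero
elements of `ker_ℤ(A)`. -/
def GraverBasis {κ ι : Type*} [Fintype ι] (A : Matrix κ ι ℤ) : Set (ι → ℤ) :=
  {g | g ≠ 0 ∧ A.mulVec g = 0 ∧
    ∀ h : ι → ℤ, h ≠ 0 → A.mulVec h = 0 → Conforms h g → h = g}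

/-- A function `ℤ → ℤ` is convex iff its successive differences are nondecreasing. -/
def IntConvex (h : ℤ → ℤ) : Prop :=
  ∀ a b : ℤ, a ≤ b → h (a + 1) - h a ≤ h (b + 1) - h b

/-- A separable convex function: a sum of univariate convex integer functions
of the individual coordinates. -/
def SepConvex {ι : Type*} [Fintype ι] (f : (ι → ℤ) → ℤ) : Prop :=
  ∃ g : ι → ℤ → ℤ, (∀ i, IntConvex (g i)) ∧ ∀ x, f x = ∑ i, g i (x i)

/-- Conformality, coordinatewise: each `y i` lies between `0` and `x i`. -/
theorem conforms_iff_between {ι : Type*} {y x : ι → ℤ} :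
    Conforms y x ↔ ∀ i, (0 ≤ y i ∧ y i ≤ x i) ∨ (x i ≤ y i ∧ y i ≤ 0) := by
  constructor
  · rintro ⟨hs, ha⟩ i
    have h1 := hs i
    have h2 := ha i
    rcases mul_nonneg_iff.mp h1 with ⟨hy, hx⟩ | ⟨hy, hx⟩
    · rw [abs_of_nonneg hy, abs_of_nonneg hx] at h2
      exact Or.inl ⟨hy, h2⟩
    · rw [abs_of_nonpos hy, abs_of_nonpos hx] at h2
      exact Or.inr ⟨by linarith, hy⟩
  · intro h
    refine ⟨fun i => ?_, fun i => ?_⟩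
    · rcases h i with ⟨h1, h2⟩ | ⟨h1, h2⟩
      · exact mul_nonneg h1 (h1.trans h2)
      · exact mul_nonneg_of_nonpos_of_nonpos h2 (h1.trans h2)
    · rcases h i with ⟨h1, h2⟩ | ⟨h1, h2⟩
      · exact abs_le_abs_of_nonneg h1 h2
      · exact abs_le_abs_of_nonpos h2 h1

theorem Conforms.refl {ι : Type*} (x : ι → ℤ) : Conforms x x :=
  ⟨fun i => mul_self_nonneg (x i), fun _ => le_rfl⟩

theorem Conforms.trans {ι : Type*} {x y z : ι → ℤ} (hxy : Conforms x y) (hyz : Conforms y z) :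
    Conforms x z := by
  rw [conforms_iff_between] at *
  intro i
  have h1 := hxy i
  have h2 := hyz i
  omega

theorem Conforms.sub_left {ι : Type*} {g z : ι → ℤ} (h : Conforms g z) : Conforms (z - g) z := by
  rw [conforms_iff_between] at *
  intro i
  have h1 := h i
  rw [Pi.sub_apply]
  omega

/-- Strict conformality strictly decreases the `ℓ¹`-norm. -/
theorem Conforms.sum_natAbs_lt {ι : Type*} [Fintype ι] {y x : ι → ℤ} (h : Conforms y x)
    (hne : y ≠ x) : ∑ i, (y i).natAbs < ∑ i, (x i).natAbs := by
  rw [conforms_iff_between] at h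
  obtain ⟨j, hj⟩ := Function.ne_iff.mp hne
  refine Finset.sum_lt_sum (fun i _ => ?_) ⟨j, Finset.mem_univ j, ?_⟩
  · have h1 := h i
    omega
  · have h1 := h j
    omega

/-- Every nonzero integer kernel element dominates a Graver basis element. -/
theorem exists_mem_graverBasis_conforms {κ ι : Type*} [Fintype ι] (A : Matrix κ ι ℤ)
    (z : ι → ℤ) (hz : z ≠ 0) (hA : A.mulVec z = 0) : ∃ g ∈ GraverBasis A, Conforms g z := by
  by_cases hmem : z ∈ GraverBasis A
  · exact ⟨z, hmem, Conforms.refl z⟩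
  · have hex : ∃ h : ι → ℤ, h ≠ 0 ∧ A.mulVec h = 0 ∧ Conforms h z ∧ h ≠ z := by
      by_contra! hcon
      exact hmem ⟨hz, hA, hcon⟩
    obtain ⟨h, h0, hAh, hhz, hne⟩ := hex
    have hlt := hhz.sum_natAbs_lt hne
    obtain ⟨g, hg, hgh⟩ := exists_mem_graverBasis_conforms A h h0 hAh
    exact ⟨g, hg, hgh.trans hhz⟩
termination_by ∑ i, (z i).natAbs

theorem IntConvex.add_le_add_of_nonneg {h : ℤ → ℤ} (hh : IntConvex h) (a : ℤ) {s t : ℤ}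
    (hs : 0 ≤ s) (ht : 0 ≤ t) : h (a + s) + h (a + t) ≤ h (a + s + t) + h a := by
  induction s, hs using Int.leInduction with
  | base => simp [add_comm]
  | succ k _ ih =>
    have h1 := hh (a + k) (a + k + t) (by linarith)
    rw [show a + k + t + 1 = a + (k + 1) + t by ring, add_assoc a k 1] at h1
    linarith

/-- Univariate convex functions are supermodular along increments of the same sign. -/
theorem IntConvex.add_le_add {h : ℤ → ℤ} (hh : IntConvex h) (a : ℤ) {s t : ℤ}
    (hst : (0 ≤ s ∧ 0 ≤ t) ∨ (s ≤ 0 ∧ t ≤ 0)) :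
    h (a + s) + h (a + t) ≤ h (a + s + t) + h a := by
  rcases hst with ⟨hs, ht⟩ | ⟨hs, ht⟩
  · exact hh.add_le_add_of_nonneg a hs ht
  · have h1 := hh.add_le_add_of_nonneg (a + s + t) (neg_nonneg.mpr hs) (neg_nonneg.mpr ht)
    rw [show a + s + t + -s = a + t by ring, show a + s + t + -t = a + s by ring,
      add_neg_cancel_right] at h1
    linarith

theorem SepConvex.add_le_add_of_conforms {ι : Type*} [Fintype ι] {f : (ι → ℤ) → ℤ}
    (hf : SepConvex f) (x : ι → ℤ) {g z : ι → ℤ} (hgz : Conforms g z) :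
    f (x + g) + f (x + (z - g)) ≤ f (x + z) + f x := by
  obtain ⟨F, hF, hfF⟩ := hf
  simp only [hfF, ← Finset.sum_add_distrib]
  refine Finset.sum_le_sum fun i _ => ?_
  have h1 := conforms_iff_between.mp hgz i
  have h2 := (hF i).add_le_add (x i) (s := g i) (t := z i - g i) (by omega)
  rw [add_assoc, add_sub_cancel] at h2
  exact h2

/-- If no Graver step from `x` inside the box improves `f`, then no kernel step does. -/
theorem SepConvex.le_add_of_graverBasis {κ ι : Type*} [Fintype ι] (A : Matrix κ ι ℤ)
    {l u x : ι → ℤ} {f : (ι → ℤ) → ℤ} (hf : SepConvex f)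
    (hxl : ∀ i, l i ≤ x i) (hxu : ∀ i, x i ≤ u i)
    (hopt : ∀ g ∈ GraverBasis A, (∀ i, l i ≤ x i + g i) → (∀ i, x i + g i ≤ u i) →
      f x ≤ f (x + g))
    (z : ι → ℤ) (hA : A.mulVec z = 0)
    (hzl : ∀ i, l i ≤ x i + z i) (hzu : ∀ i, x i + z i ≤ u i) : f x ≤ f (x + z) := by
  by_cases hz : z = 0
  · simp [hz]
  have hbox : ∀ w, Conforms w z → (∀ i, l i ≤ x i + w i) ∧ ∀ i, x i + w i ≤ u i := by
    intro w hw
    rw [conforms_iff_between] at hw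
    constructor <;> intro i <;> rcases hw i with ⟨h1, h2⟩ | ⟨h1, h2⟩ <;>
      linarith [hxl i, hxu i, hzl i, hzu i]
  obtain ⟨g, hg, hgz⟩ := exists_mem_graverBasis_conforms A z hz hA
  have hlt := hgz.sub_left.sum_natAbs_lt fun h => hg.1 (sub_eq_self.mp h)
  have hsub := SepConvex.le_add_of_graverBasis A hf hxl hxu hopt (z - g)
    (by rw [Matrix.mulVec_sub, hA, hg.2.1, sub_zero])
    (hbox _ hgz.sub_left).1 (hbox _ hgz.sub_left).2
  have hstep := hopt g hg (hbox g hgz).1 (hbox g hgz).2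
  linarith [hf.add_le_add_of_conforms x hgz]
termination_by ∑ i, (z i).natAbs

/-- If no Graver basis element with any step length gives an augmenting feasible
step from the feasible point `x`, then `x` is optimal for the integer program
`min{f(x) : Ax = b, l ≤ x ≤ u}` with separable convex `f`. -/
theorem graver_optimality_certificate {m n : ℕ}
    (A : Matrix (Fin m) (Fin n) ℤ) (b : Fin m → ℤ) (l u : Fin n → ℤ)
    (hlu : ∀ i, l i ≤ u i)
    (f : (Fin n → ℤ) → ℤ) (hf : SepConvex f)
    (x : Fin n → ℤ) (hxA : A.mulVec x = b)
    (hxl : ∀ i, l i ≤ x i) (hxu : ∀ i, x i ≤ u i)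
    (hopt : ∀ g ∈ GraverBasis A, ∀ α : ℤ,
      (∀ i, l i ≤ x i + α * g i) → (∀ i, x i + α * g i ≤ u i) →
      f x ≤ f (x + α • g)) :
    ∀ y : Fin n → ℤ, A.mulVec y = b → (∀ i, l i ≤ y i) → (∀ i, y i ≤ u i) →
      f x ≤ f y := by
  intro y hy hyl hyu
  have h := hf.le_add_of_graverBasis A hxl hxu
    (fun g hg h1 h2 => by simpa using hopt g hg 1 (by simpa using h1) (by simpa using h2))
    (y - x) (by rw [Matrix.mulVec_sub, hy, hxA, sub_self])
    (by simpa using hyl) (by simpa using hyu)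
  rwa [add_sub_cancel] at h
end

section
/- Let D ∈ ℤ^{r×t}, let E = (D; 1ᵀ) with 1ᵀ = (1 ⋯ 1) ∈ ℤ^{1×t}, let Δ = 1 + ‖D‖_∞ where ‖D‖_∞ is the maximum absolute value of an entry of D, and set g(E) := t²(2rΔ)^r. Then for every n ≥ 1 and every g = (g^1,…,g^n) ∈ 𝒢(E^{(n)}): (i) ‖g‖_∞ ≤ g(E), i.e. every entry of g has absolute value at most g(E); and (ii) for every brick index i ∈ [n] and every j ∈ [t], the brick prefix sum satisfies |Σ_{ℓ=1}^{j} g^i_ℓ| ≤ g(E). -/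
/-- The `n`-fold product `E^{(n)}` of the bimatrix `E = (D; A)`. -/
def nFold {r s t : ℕ} (n : ℕ) (D : Matrix (Fin r) (Fin t) ℤ)
    (A : Matrix (Fin s) (Fin t) ℤ) :
    Matrix (Fin r ⊕ (Fin n × Fin s)) (Fin n × Fin t) ℤ :=
  Matrix.of fun I q =>
    match I with
    | Sum.inl a => D a q.2
    | Sum.inr ia => if q.1 = ia.1 then A ia.2 q.2 else 0

/-- The `1 × t` all-ones row matrix `1ᵀ`. -/
def onesRow (t : ℕ) : Matrix (Fin 1) (Fin t) ℤ := Matrix.of fun _ _ => 1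

/-- The maximum absolute value `‖D‖_∞` of an entry of `D`, as a natural number. -/
def matInfNorm {r t : ℕ} (D : Matrix (Fin r) (Fin t) ℤ) : ℕ :=
  Finset.univ.sup fun q : Fin r × Fin t => (D q.1 q.2).natAbs

/-- A smaller total can be attained by decreasing the summands. -/
theorem exists_le_sum_eq {ι : Type*} [Fintype ι] (F : ι → ℕ) (m : ℕ) (hm : m ≤ ∑ i, F i) :
    ∃ F' : ι → ℕ, F' ≤ F ∧ ∑ i, F' i = m := by
  classical
  induction m with
  | zero => exact ⟨0, fun i => Nat.zero_le _, by simp⟩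
  | succ m ih =>
    obtain ⟨F', hle, hsum⟩ := ih (by omega)
    obtain ⟨i, -, hi⟩ := Finset.exists_lt_of_sum_lt (s := Finset.univ) (f := F') (g := F) (by omega)
    refine ⟨F' + Pi.single i 1, fun j => ?_, ?_⟩
    · rcases eq_or_ne j i with rfl | hj
      · simpa using hi
      · simpa [hj] using hle j
    · simp [Finset.sum_add_distrib, hsum]

/-- An integer vector with zero sum is a conformal sum of differences of unit vectors. -/
theorem exists_transport {ι : Type*} [Fintype ι] (x : ι → ℤ) (hx : ∑ i, x i = 0) :
    ∃ f : ι → ι → ℕ, (∀ a, x a = ∑ b, (f a b : ℤ) - ∑ b, (f b a : ℤ)) ∧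
      ∀ a b, 0 < f a b → 0 < x a ∧ x b < 0 := by
  classical
  induction hN : ∑ i, (x i).natAbs using Nat.strong_induction_on generalizing x with
  | _ N ih =>
    by_cases h0 : ∀ i, x i = 0
    · exact ⟨0, by simp [h0], by simp⟩
    push Not at h0
    obtain ⟨i, hi⟩ := h0
    obtain ⟨a, -, ha⟩ := Finset.exists_pos_of_sum_zero_of_exists_nonzero x hx ⟨i, by simp, hi⟩
    obtain ⟨b, -, hb⟩ := Finset.exists_pos_of_sum_zero_of_exists_nonzero (s := Finset.univ)
      (fun i => -x i) (by simp [hx]) ⟨i, by simp, by simpa using hi⟩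
    have hb : x b < 0 := by simpa using hb
    have hab : a ≠ b := by rintro rfl; omega
    let y : ι → ℤ := x - Pi.single a 1 + Pi.single b 1
    have hya : y a = x a - 1 := by simp [y, hab]
    have hyb : y b = x b + 1 := by simp [y, hab.symm]
    have hy : ∀ c, c ≠ a → c ≠ b → y c = x c := fun c h1 h2 => by simp [y, h1, h2]
    have hlt : ∑ i, (y i).natAbs < N := by
      rw [← hN]
      refine Finset.sum_lt_sum (fun c _ => ?_) ⟨a, by simp, by omega⟩
      by_cases h1 : c = a
      · subst h1; omega
      by_cases h2 : c = b
      · subst h2; omega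
      rw [hy c h1 h2]
    obtain ⟨f, hf, hpos⟩ := ih _ hlt y
      (by simp [y, Finset.sum_add_distrib, Finset.sum_sub_distrib, hx]) rfl
    have hsum₁ : ∀ c, ∑ d, ((if c = a ∧ d = b then 1 else 0 : ℕ) : ℤ) = if c = a then 1 else 0 := by
      intro c; by_cases h : c = a <;> simp [h]
    have hsum₂ : ∀ c, ∑ d, ((if d = a ∧ c = b then 1 else 0 : ℕ) : ℤ) = if c = b then 1 else 0 := by
      intro c; by_cases h : c = b <;> simp [h]
    refine ⟨fun c d => f c d + if c = a ∧ d = b then 1 else 0, fun c => ?_, fun c d hcd => ?_⟩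
    · simp only [Nat.cast_add, Finset.sum_add_distrib, hsum₁, hsum₂]
      have := hf c
      by_cases h1 : c = a
      · subst h1; simp only [if_true, if_neg hab]; omega
      by_cases h2 : c = b
      · subst h2; simp only [if_true, if_neg h1]; omega
      rw [hy c h1 h2] at this
      simp only [if_neg h1, if_neg h2]; omega
    · by_cases h : c = a ∧ d = b
      · rw [h.1, h.2]; exact ⟨ha, hb⟩
      · simp only [if_neg h, add_zero] at hcd
        obtain ⟨h1, h2⟩ := hpos c d hcd
        constructor
        · by_cases h3 : c = a
          · rw [h3]; exact ha
          by_cases h4 : c = b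
          · subst h4; omega
          rwa [hy c h3 h4] at h1
        · by_cases h4 : d = b
          · rw [h4]; exact hb
          by_cases h3 : d = a
          · subst h3; omega
          rwa [hy d h3 h4] at h2

/-- A matrix with linearly independent columns has a nonsingular maximal square submatrix. -/
theorem exists_det_submatrix_ne_zero {κ τ K : Type*} [Field K] [Fintype κ] [Fintype τ]
    [DecidableEq τ] (A : Matrix κ τ K) (hA : LinearIndependent K A.col) :
    ∃ e : τ → κ, Function.Injective e ∧ (A.submatrix e id).det ≠ 0 := by
  obtain ⟨σ, a, ha, hspan, hli⟩ := exists_linearIndependent' K A.row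
  have : Fintype σ := Fintype.ofInjective a ha
  have hcard : Fintype.card τ = Fintype.card σ := by
    rw [linearIndependent_iff_card_eq_finrank_span.mp hli, Set.finrank, hspan,
      ← A.rank_eq_finrank_span_row, A.rank_eq_finrank_span_cols]
    exact linearIndependent_iff_card_eq_finrank_span.mp hA
  let e := Fintype.equivOfCardEq hcard
  refine ⟨a ∘ e, ha.comp e.injective, ?_⟩
  have h : LinearIndependent K (A.submatrix (a ∘ e) id).row := hli.comp e e.injective
  exact ((Matrix.isUnit_iff_isUnit_det _).mp (Matrix.linearIndependent_rows_iff_isUnit.mp h)).ne_zero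

/-- Subtracting a suitable multiple of `z` from `x ≥ 0` keeps `x` nonnegative and kills a coordinate
at which `z` is positive. -/
theorem exists_sub_smul_nonneg {ι : Type*} [Fintype ι] (x z : ι → ℚ) (hx : 0 ≤ x)
    (hz : ∃ i, 0 < z i) (hsupp : ∀ i, x i = 0 → z i = 0) :
    ∃ α : ℚ, 0 < α ∧ 0 ≤ x - α • z ∧ (∃ i, x i ≠ 0 ∧ (x - α • z) i = 0) := by
  classical
  obtain ⟨i₀, hi₀⟩ := hz
  obtain ⟨i, hi, hmin⟩ := Finset.exists_min_image (Finset.univ.filter fun i => 0 < z i)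
    (fun i => x i / z i) ⟨i₀, by simpa using hi₀⟩
  simp only [Finset.mem_filter, Finset.mem_univ, true_and] at hi hmin
  have hxi : x i ≠ 0 := fun h => hi.ne' (hsupp i h)
  have hxi' : 0 < x i := lt_of_le_of_ne (hx i) hxi.symm
  refine ⟨x i / z i, by positivity, fun j => ?_, i, hxi, ?_⟩
  · simp only [Pi.zero_apply, Pi.sub_apply, Pi.smul_apply, smul_eq_mul, sub_nonneg]
    rcases lt_or_ge 0 (z j) with h | h
    · exact (le_div_iff₀ h).mp (hmin j h)
    · exact (mul_nonpos_of_nonneg_of_nonpos (by positivity) h).trans (hx j)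
  · simp only [Pi.sub_apply, Pi.smul_apply, smul_eq_mul]
    field_simp
    ring

open Finset in
theorem card_support_sub_smul_lt {ι : Type*} [Fintype ι] (x z : ι → ℚ) (α : ℚ)
    (hsupp : ∀ i, x i = 0 → z i = 0) (h : ∃ i, x i ≠ 0 ∧ (x - α • z) i = 0) :
    #{i | (x - α • z) i ≠ 0} < #{i | x i ≠ 0} := by
  obtain ⟨i, hi, hi'⟩ := h
  refine Finset.card_lt_card (Finset.ssubset_iff_subset_ne.mpr ⟨fun j => ?_, fun heq => ?_⟩)
  · simp only [Finset.mem_filter, Finset.mem_univ, true_and]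
    exact fun hj hx => hj (by simp [hx, hsupp j hx])
  · have : i ∈ ({i | x i ≠ 0} : Finset ι) := by simpa using hi
    rw [← heq] at this
    simp at this
    exact this (by simpa using hi')

open Finset in
/-- A nonzero nonnegative kernel vector dominates, in support, one that spans the kernel vectors
supported on its own support. -/
theorem exists_minimal_support {κ ι : Type*} [Fintype ι] (V : Matrix κ ι ℚ) (x : ι → ℚ)
    (hx : 0 ≤ x) (hne : x ≠ 0) (hker : V.mulVec x = 0) :
    ∃ y : ι → ℚ, 0 ≤ y ∧ y ≠ 0 ∧ V.mulVec y = 0 ∧ (∀ i, x i = 0 → y i = 0) ∧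
      ∀ z : ι → ℚ, V.mulVec z = 0 → (∀ i, y i = 0 → z i = 0) → ∃ s : ℚ, z = s • y := by
  induction hN : #{i | x i ≠ 0} using Nat.strong_induction_on generalizing x with
  | _ N ih =>
    by_cases h : ∀ z : ι → ℚ, V.mulVec z = 0 → (∀ i, x i = 0 → z i = 0) → ∃ s : ℚ, z = s • x
    · exact ⟨x, hx, hne, hker, fun _ => id, h⟩
    push Not at h
    have : ∃ z : ι → ℚ, V.mulVec z = 0 ∧ (∀ i, x i = 0 → z i = 0) ∧ (∀ s : ℚ, z ≠ s • x) ∧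
        ∃ i, 0 < z i := by
      obtain ⟨z, hz, hs, hn⟩ := h
      by_cases hp : ∃ i, 0 < z i
      · exact ⟨z, hz, hs, hn, hp⟩
      push Not at hp
      have hz0 : z ≠ 0 := by simpa using hn 0
      obtain ⟨i, hi⟩ := Function.ne_iff.mp hz0
      refine ⟨-z, by simp [Matrix.mulVec_neg, hz], fun i hi => by simp [hs i hi], fun s hsz => ?_, i,
        by simpa using lt_of_le_of_ne (hp i) hi⟩
      exact hn (-s) (by rw [neg_smul, ← hsz, neg_neg])
    obtain ⟨z, hz, hs, hn, hp⟩ := this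
    obtain ⟨α, hα, hnonneg, hex⟩ := exists_sub_smul_nonneg x z hx hp hs
    have hlt := card_support_sub_smul_lt x z α hs hex
    obtain ⟨y, h1, h2, h3, h4, h5⟩ := ih _ (hN ▸ hlt) (x - α • z) hnonneg
      (fun h0 => hn α⁻¹ (by rw [sub_eq_zero.mp h0, smul_smul, inv_mul_cancel₀ hα.ne', one_smul]))
      (by simp [Matrix.mulVec_sub, Matrix.mulVec_smul, hker, hz]) rfl
    exact ⟨y, h1, h2, h3, fun i hi => h4 i (by simp [hi, hs i hi]), h5⟩

/-- The Leibniz bound on an integer determinant, as a natural number. -/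
theorem natAbs_det_le {τ : Type*} [Fintype τ] [DecidableEq τ] (B : Matrix τ τ ℤ) (M : ℕ)
    (hB : ∀ i j, (B i j).natAbs ≤ M) :
    B.det.natAbs ≤ (Fintype.card τ).factorial * M ^ Fintype.card τ := by
  have := Matrix.det_le (A := B) (abv := AbsoluteValue.abs) (x := (M : ℤ))
    (fun i j => by
      have := hB i j
      rw [AbsoluteValue.abs_apply, Int.abs_eq_natAbs]; exact_mod_cast this)
  rw [AbsoluteValue.abs_apply, Int.abs_eq_natAbs, nsmul_eq_mul] at this
  exact_mod_cast this

open Finset in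
/-- Below any nonzero nonnegative kernel vector there is, in support, an integer one whose entries
sum to at most a determinant bound. -/
theorem exists_small_circuit {κ ι : Type*} [Fintype κ] [Fintype ι] (V : Matrix κ ι ℤ) (M : ℕ)
    (hM : 1 ≤ M) (hV : ∀ k i, (V k i).natAbs ≤ M) (x : ι → ℚ) (hx : 0 ≤ x) (hne : x ≠ 0)
    (hker : (V.map (Int.cast : ℤ → ℚ)).mulVec x = 0) :
    ∃ c : ι → ℕ, c ≠ 0 ∧ (∀ i, x i = 0 → c i = 0) ∧ V.mulVec (fun i => (c i : ℤ)) = 0 ∧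
      ∑ i, c i ≤ (Fintype.card κ + 1).factorial * M ^ Fintype.card κ := by
  classical
  obtain ⟨y, hy, hyne, hyker, hyx, hmin⟩ := exists_minimal_support _ x hx hne hker
  obtain ⟨i₀, hi₀ : y i₀ ≠ 0⟩ := Function.ne_iff.mp hyne
  have hpos : 0 < y i₀ := lt_of_le_of_ne (hy i₀) hi₀.symm
  obtain ⟨P, hP⟩ : ∃ P : ι → Prop, ∀ i, P i ↔ y i ≠ 0 ∧ i ≠ i₀ := ⟨_, fun _ => Iff.rfl⟩
  have hPi₀ : ¬ P i₀ := fun h => ((hP i₀).mp h).2 rfl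
  let A : Matrix κ {i // P i} ℚ := (V.map (Int.cast : ℤ → ℚ)).submatrix id Subtype.val
  have hA : LinearIndependent ℚ A.col := by
    rw [Fintype.linearIndependent_iff]
    intro g hg
    let z : ι → ℚ := Function.extend Subtype.val g 0
    have hzT : ∀ t : {i // P i}, z t = g t := fun t => Subtype.val_injective.extend_apply _ _ _
    have hzN : ∀ i, ¬ P i → z i = 0 := fun i hi =>
      Function.extend_apply' _ _ _ (by rintro ⟨t, rfl⟩; exact hi t.2)
    obtain ⟨s, hs⟩ := hmin z (by
      ext k
      simp only [Matrix.mulVec, dotProduct, Pi.zero_apply]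
      have h0 : ∑ t : {i // ¬ P i}, V.map (Int.cast : ℤ → ℚ) k t * z t = 0 :=
        Fintype.sum_eq_zero _ fun t => by rw [hzN t t.2, mul_zero]
      rw [← Fintype.sum_subtype_add_sum_subtype P, h0, add_zero]
      have := congrFun hg k
      simp only [Finset.sum_apply, Pi.smul_apply, smul_eq_mul, Pi.zero_apply] at this
      rw [← this]
      exact Finset.sum_congr rfl fun t _ => by rw [hzT, mul_comm]; rfl)
      (fun i hi => hzN i fun h => ((hP i).mp h).1 hi)
    have h0 := congrFun hs i₀
    rw [hzN i₀ hPi₀] at h0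
    have hs0 : s = 0 := by simpa [hi₀] using h0.symm
    intro t
    rw [← hzT, hs, hs0]; simp
  obtain ⟨e, he, hdet⟩ := exists_det_submatrix_ne_zero A hA
  let B : Matrix {i // P i} {i // P i} ℤ := V.submatrix e Subtype.val
  let b : {i // P i} → ℤ := fun t => V (e t) i₀
  have hBmap : A.submatrix e id = B.map (Int.cast : ℤ → ℚ) := rfl
  have hdetB : ((B.det : ℤ) : ℚ) = (A.submatrix e id).det := by rw [hBmap, Int.cast_det]
  have hBy : (A.submatrix e id).mulVec (fun t => y t) = (-y i₀) • fun t => (b t : ℚ) := by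
    ext k
    have := congrFun hyker (e k)
    simp only [Matrix.mulVec, dotProduct, Pi.zero_apply] at this
    rw [← Fintype.sum_subtype_add_sum_subtype P] at this
    rw [Fintype.sum_eq_single (⟨i₀, hPi₀⟩ : {i // ¬ P i})] at this
    · simp only [Matrix.mulVec, dotProduct, Pi.smul_apply, smul_eq_mul, b]
      simp only [Matrix.map_apply] at this
      simp only [Matrix.submatrix_apply, Matrix.map_apply, A, id]
      linarith
    · rintro ⟨i, hi⟩ hne'
      have : y i = 0 := by
        by_contra h
        exact hi <| (hP i).mpr ⟨h, fun h' => hne' (Subtype.ext h')⟩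
      simp [this]
  have hcram : ∀ t : {i // P i}, (B.det : ℚ) * y t = -y i₀ * (B.cramer b t : ℚ) := by
    have h1 := congrArg (A.submatrix e id).cramer hBy
    rw [map_smul] at h1
    rw [Matrix.cramer_eq_adjugate_mulVec, Matrix.mulVec_mulVec, Matrix.adjugate_mul,
      Matrix.smul_mulVec, Matrix.one_mulVec] at h1
    intro t
    have h2 := congrFun h1 t
    simp only [Pi.smul_apply, smul_eq_mul] at h2
    rw [hdetB, h2, Matrix.cramer_apply, Matrix.cramer_apply, Int.cast_det]
    congr 2
    ext k l
    by_cases hl : l = t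
    · subst hl; simp
    · simp [hl, hBmap]
  have hdet0 : (B.det : ℚ) ≠ 0 := hdetB ▸ hdet
  set K := (Fintype.card {i // P i}).factorial * M ^ Fintype.card {i // P i} with hK
  have hex : ∀ i, ∃ m : ℕ, m ≤ K ∧ (m : ℚ) = |(B.det : ℚ)| / y i₀ * y i := by
    intro i
    by_cases h0 : y i = 0
    · exact ⟨0, Nat.zero_le _, by simp [h0]⟩
    by_cases h1 : i = i₀
    · subst h1
      refine ⟨B.det.natAbs, natAbs_det_le B M fun _ _ => hV _ _, ?_⟩
      rw [div_mul_cancel₀ _ h0, Nat.cast_natAbs, Int.cast_abs]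
    · refine ⟨(B.cramer b ⟨i, (hP i).mpr ⟨h0, h1⟩⟩).natAbs, ?_, ?_⟩
      · rw [Matrix.cramer_apply]
        refine natAbs_det_le _ M fun k l => ?_
        rw [Matrix.updateCol_apply]
        split_ifs
        · exact hV _ _
        · exact hV _ _
      · have := congrArg abs (hcram ⟨i, (hP i).mpr ⟨h0, h1⟩⟩)
        rw [abs_mul, abs_mul, abs_neg, abs_of_nonneg (hy i), abs_of_pos hpos] at this
        rw [Nat.cast_natAbs, Int.cast_abs, div_mul_eq_mul_div, this]
        field_simp
  choose c hcK hc using hex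
  have hc0 : ∀ i, y i = 0 → c i = 0 := fun i hi => by
    have := hc i
    rw [hi, mul_zero] at this
    exact_mod_cast this
  refine ⟨c, fun h => ?_, fun i hi => hc0 i (hyx i hi), ?_, ?_⟩
  · have := hc i₀
    rw [h, div_mul_cancel₀ _ hi₀] at this
    exact hdet0 (by simpa using this.symm)
  · ext k
    have h1 : (((V.mulVec fun i => (c i : ℤ)) k : ℤ) : ℚ)
        = |(B.det : ℚ)| / y i₀ * ((V.map (Int.cast : ℤ → ℚ)).mulVec y) k := by
      simp only [Matrix.mulVec, dotProduct, Int.cast_sum, Int.cast_mul, Int.cast_natCast, hc,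
        Finset.mul_sum, Matrix.map_apply]
      exact Finset.sum_congr rfl fun i _ => by ring
    rw [hyker, Pi.zero_apply, mul_zero] at h1
    exact_mod_cast h1
  · have hsub : Fintype.card {i // P i} + 1 = #{i | y i ≠ 0} := by
      rw [Fintype.card_subtype, ← Finset.card_erase_add_one (a := i₀) (s := {i | y i ≠ 0})
        (by simpa using hi₀)]
      congr 2
      ext i
      simp [hP, and_comm]
    have hle : Fintype.card {i // P i} ≤ Fintype.card κ := Fintype.card_le_of_injective e he
    calc ∑ i, c i = ∑ i with y i ≠ 0, c i := by
          refine (Finset.sum_subset (Finset.filter_subset _ _) fun i _ hi => hc0 i ?_).symm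
          simpa using hi
      _ ≤ #{i | y i ≠ 0} * K := by
          simpa using Finset.sum_le_card_nsmul _ _ K fun i _ => hcK i
      _ = (Fintype.card {i // P i} + 1).factorial * M ^ Fintype.card {i // P i} := by
          rw [← hsub, hK, Nat.factorial_succ, mul_assoc]
      _ ≤ _ := by gcongr

open Finset in
/-- A nonnegative kernel vector with large coordinate sum dominates a small integer one. -/
theorem exists_small_le_or_sum_le {κ ι : Type*} [Fintype κ] [Fintype ι] (V : Matrix κ ι ℤ)
    (M : ℕ) (hM : 1 ≤ M) (hV : ∀ k i, (V k i).natAbs ≤ M) (x : ι → ℚ) (hx : 0 ≤ x)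
    (hker : (V.map (Int.cast : ℤ → ℚ)).mulVec x = 0) :
    (∃ c : ι → ℕ, c ≠ 0 ∧ (∀ i, (c i : ℚ) ≤ x i) ∧ V.mulVec (fun i => (c i : ℤ)) = 0 ∧
      ∑ i, c i ≤ (Fintype.card κ + 1).factorial * M ^ Fintype.card κ) ∨
    ∑ i, x i ≤
      #{i | x i ≠ 0} * (((Fintype.card κ + 1).factorial * M ^ Fintype.card κ : ℕ) : ℚ) := by
  induction hN : #{i | x i ≠ 0} using Nat.strong_induction_on generalizing x with
  | _ N ih =>
    by_cases hne : x = 0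
    · right; simp only [hne, Pi.zero_apply, Finset.sum_const_zero]; positivity
    obtain ⟨c, hc, hcx, hck, hcs⟩ := exists_small_circuit V M hM hV x hx hne hker
    set K := (Fintype.card κ + 1).factorial * M ^ Fintype.card κ
    let z : ι → ℚ := fun i => c i
    have hz : ∀ i, x i = 0 → z i = 0 := fun i hi => by simp [z, hcx i hi]
    obtain ⟨i, hi⟩ := Function.ne_iff.mp hc
    obtain ⟨α, hα, hnn, hex⟩ := exists_sub_smul_nonneg x z hx
      ⟨i, by simpa [z] using Nat.pos_of_ne_zero hi⟩ hz
    have hsub : ∀ i, α * c i ≤ x i := fun i => by simpa [z] using hnn i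
    rcases le_or_gt 1 α with h1 | h1
    · exact .inl ⟨c, hc, fun i => (le_mul_of_one_le_left (by positivity) h1).trans (hsub i),
        hck, hcs⟩
    have hlt := hN ▸ card_support_sub_smul_lt x z α hz hex
    have hzk : (V.map (Int.cast : ℤ → ℚ)).mulVec z = 0 := by
      ext k
      have := congrFun hck k
      simp only [Matrix.mulVec, dotProduct, Pi.zero_apply, Matrix.map_apply, z] at this ⊢
      exact_mod_cast this
    rcases ih _ hlt (x - α • z) hnn
      (by simp [Matrix.mulVec_sub, Matrix.mulVec_smul, hker, hzk]) rfl with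
      ⟨c', h2, h3, h4⟩ | h
    · refine .inl ⟨c', h2, fun i => (h3 i).trans ?_, h4⟩
      simp only [Pi.sub_apply, Pi.smul_apply, smul_eq_mul, z, sub_le_self_iff]
      positivity
    · right
      have h5 : ∑ i, (x - α • z) i = ∑ i, x i - α * ((∑ i, c i : ℕ) : ℚ) := by
        simp [Finset.sum_sub_distrib, Finset.mul_sum, z]
      have h6 : α * ((∑ i, c i : ℕ) : ℚ) ≤ 1 * (K : ℚ) := by gcongr
      have h7 : ((#{i | (x - α • z) i ≠ 0} : ℕ) : ℚ) + 1 ≤ N := by exact_mod_cast hlt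
      nlinarith [mul_le_mul_of_nonneg_right h7 (Nat.cast_nonneg (α := ℚ) K)]

open Finset in
/-- A nonnegative integer kernel vector that is minimal in the componentwise order has a small
coordinate sum. -/
theorem sum_le_of_minimal {κ ι : Type*} [Fintype κ] [Fintype ι] (V : Matrix κ ι ℤ)
    (M : ℕ) (hM : 1 ≤ M) (hV : ∀ k i, (V k i).natAbs ≤ M) (w : ι → ℕ) (hw : w ≠ 0)
    (hker : V.mulVec (fun i => (w i : ℤ)) = 0)
    (hmin : ∀ u : ι → ℕ, u ≠ 0 → u ≤ w → V.mulVec (fun i => (u i : ℤ)) = 0 →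
      ∑ i, u i = ∑ i, w i) :
    ∑ i, w i ≤ #{i | w i ≠ 0} * ((Fintype.card κ + 1).factorial * M ^ Fintype.card κ) := by
  have hcard : 1 ≤ #{i | w i ≠ 0} := by
    obtain ⟨i, hi⟩ := Function.ne_iff.mp hw
    exact Finset.card_pos.mpr ⟨i, by simpa using hi⟩
  rcases exists_small_le_or_sum_le V M hM hV (fun i => (w i : ℚ)) (fun i => by simp) (by
      ext k
      have := congrFun hker k
      simp only [Matrix.mulVec, dotProduct, Pi.zero_apply, Matrix.map_apply] at this ⊢
      exact_mod_cast this) with ⟨c, h1, h2, h3, h4⟩ | h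
  · rw [← hmin c h1 (fun i => by exact_mod_cast h2 i) h3]
    exact h4.trans (Nat.le_mul_of_pos_left _ hcard)
  · simp only [ne_eq, Nat.cast_eq_zero] at h
    exact_mod_cast h

theorem natAbs_le_matInfNorm {r t : ℕ} (D : Matrix (Fin r) (Fin t) ℤ) (k : Fin r) (a : Fin t) :
    (D k a).natAbs ≤ matInfNorm D :=
  Finset.le_sup (f := fun q : Fin r × Fin t => (D q.1 q.2).natAbs) (Finset.mem_univ (k, a))

theorem nFold_onesRow_mulVec_eq_zero_iff {r t n : ℕ} (D : Matrix (Fin r) (Fin t) ℤ)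
    (x : Fin n × Fin t → ℤ) :
    (nFold n D (onesRow t)).mulVec x = 0 ↔
      (∀ k, ∑ i, ∑ a, D k a * x (i, a) = 0) ∧ ∀ i, ∑ a, x (i, a) = 0 := by
  have h₁ : ∀ k, (nFold n D (onesRow t)).mulVec x (Sum.inl k) = ∑ i, ∑ a, D k a * x (i, a) := by
    intro k
    simp [Matrix.mulVec, dotProduct, nFold, Fintype.sum_prod_type]
  have h₂ : ∀ i j, (nFold n D (onesRow t)).mulVec x (Sum.inr (i, j)) = ∑ a, x (i, a) := by
    intro i j
    simp only [Matrix.mulVec, dotProduct, nFold, onesRow, Fintype.sum_prod_type, Matrix.of_apply,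
      ite_mul, one_mul, zero_mul]
    rw [Fintype.sum_eq_single i (fun i' hi' => by simp [hi'])]
    simp
  constructor
  · intro h
    exact ⟨fun k => by rw [← h₁, h]; rfl, fun i => by rw [← h₂ i 0, h]; rfl⟩
  · rintro ⟨h, h'⟩
    ext (k | ⟨i, j⟩)
    · rw [h₁, h]; rfl
    · rw [h₂, h']; rfl

/-- The net outflow at each vertex of a flow on the complete digraph. -/
def netFlow {ι : Type*} [Fintype ι] (f : ι → ι → ℕ) (a : ι) : ℤ :=
  ∑ b, (f a b : ℤ) - ∑ b, (f b a : ℤ)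

theorem sum_mul_netFlow {ι : Type*} [Fintype ι] (f : ι → ι → ℕ) (d : ι → ℤ) :
    ∑ a, d a * netFlow f a = ∑ a, ∑ b, (d a - d b) * (f a b : ℤ) := by
  simp only [netFlow, mul_sub, Finset.sum_sub_distrib, sub_mul, Finset.mul_sum]
  rw [Finset.sum_comm (f := fun a b => d a * (f b a : ℤ))]

theorem sum_netFlow {ι : Type*} [Fintype ι] (f : ι → ι → ℕ) : ∑ a, netFlow f a = 0 := by
  simpa using sum_mul_netFlow f 1

theorem natAbs_sum_netFlow_le {ι : Type*} [Fintype ι] (f : ι → ι → ℕ) (s : Finset ι) :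
    (∑ a ∈ s, netFlow f a).natAbs ≤ ∑ a, ∑ b, f a b := by
  have h₁ : ∑ a ∈ s, ∑ b, f a b ≤ ∑ a, ∑ b, f a b :=
    Finset.sum_le_sum_of_subset (Finset.subset_univ _)
  have h₂ : ∑ a ∈ s, ∑ b, f b a ≤ ∑ a, ∑ b, f a b :=
    (Finset.sum_le_sum_of_subset (Finset.subset_univ _)).trans_eq Finset.sum_comm
  have h₃ : ∑ a ∈ s, netFlow f a
      = ((∑ a ∈ s, ∑ b, f a b : ℕ) : ℤ) - ((∑ a ∈ s, ∑ b, f b a : ℕ) : ℤ) := by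
    simp [netFlow, Finset.sum_sub_distrib]
  omega

/-- If no vertex has both inflow and outflow in `f`, then the net flow of a subflow conforms to
that of `f`, and no flow cancels. -/
theorem netFlow_conforms {ι : Type*} [Fintype ι] (f f' : ι → ι → ℕ)
    (hf : ∀ a b, 0 < f a b → 0 < netFlow f a ∧ netFlow f b < 0) (hle : ∀ a b, f' a b ≤ f a b)
    (a : ι) :
    0 ≤ netFlow f' a * netFlow f a ∧ |netFlow f' a| ≤ |netFlow f a| ∧
      |netFlow f' a| = ∑ b, (f' a b : ℤ) + ∑ b, (f' b a : ℤ) := by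
  have hout : ∑ b, (f' a b : ℤ) ≤ ∑ b, (f a b : ℤ) :=
    Finset.sum_le_sum fun b _ => by exact_mod_cast hle a b
  have hin : ∑ b, (f' b a : ℤ) ≤ ∑ b, (f b a : ℤ) :=
    Finset.sum_le_sum fun b _ => by exact_mod_cast hle b a
  have hout0 : 0 ≤ ∑ b, (f' a b : ℤ) := Finset.sum_nonneg fun b _ => by positivity
  have hin0 : 0 ≤ ∑ b, (f' b a : ℤ) := Finset.sum_nonneg fun b _ => by positivity
  rcases le_or_gt 0 (netFlow f a) with h | h
  · have h0 : ∑ b, (f b a : ℤ) = 0 := Finset.sum_eq_zero fun b _ => by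
      by_contra hne
      have := (hf b a (by omega)).2
      omega
    have e : netFlow f a = ∑ b, (f a b : ℤ) := by simp [netFlow, h0]
    have e' : netFlow f' a = ∑ b, (f' a b : ℤ) := by rw [netFlow]; omega
    rw [e, e', abs_of_nonneg hout0, abs_of_nonneg (hout0.trans hout)]
    exact ⟨mul_nonneg hout0 (hout0.trans hout), hout, by omega⟩
  · have h0 : ∑ b, (f a b : ℤ) = 0 := Finset.sum_eq_zero fun b _ => by
      by_contra hne
      have := (hf a b (by omega)).1
      omega
    have e : netFlow f a = -∑ b, (f b a : ℤ) := by simp [netFlow, h0]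
    have e' : netFlow f' a = -∑ b, (f' b a : ℤ) := by rw [netFlow]; omega
    rw [e, e', abs_neg, abs_neg, abs_of_nonneg hin0, abs_of_nonneg (hin0.trans hin), neg_mul_neg]
    exact ⟨mul_nonneg hin0 (hin0.trans hin), hin, by omega⟩

/-- The matrix whose columns are the pairwise differences of columns of `D`. -/
def colDiff {r t : ℕ} (D : Matrix (Fin r) (Fin t) ℤ) : Matrix (Fin r) (Fin t × Fin t) ℤ :=
  Matrix.of fun k p => D k p.1 - D k p.2

theorem nFold_mulVec_netFlow_eq_zero_iff {r t n : ℕ} (D : Matrix (Fin r) (Fin t) ℤ)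
    (f : Fin n → Fin t → Fin t → ℕ) :
    (nFold n D (onesRow t)).mulVec (fun q => netFlow (f q.1) q.2) = 0 ↔
      (colDiff D).mulVec (fun p => ((∑ i, f i p.1 p.2 : ℕ) : ℤ)) = 0 := by
  rw [nFold_onesRow_mulVec_eq_zero_iff]
  simp only [sum_netFlow, implies_true, and_true, sum_mul_netFlow, funext_iff]
  refine forall_congr' fun k => ?_
  simp only [Matrix.mulVec, dotProduct, colDiff, Fintype.sum_prod_type, Matrix.of_apply,
    Nat.cast_sum, Finset.mul_sum, Pi.zero_apply]
  rw [Finset.sum_comm]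
  simp only [Finset.sum_comm (s := (Finset.univ : Finset (Fin n)))]

theorem factorial_succ_le_two_mul_pow (r : ℕ) : (r + 1).factorial ≤ 2 * r ^ r := by
  induction r with
  | zero => simp
  | succ r ih =>
    rw [Nat.factorial_succ]
    rcases Nat.eq_zero_or_pos r with rfl | hr
    · simp
    have h : (r + 2) * r ^ r ≤ (r + 1) ^ (r + 1) := by
      have h1 : r ^ (r + 1) + (r + 1) * r ^ r ≤ (r + 1) ^ (r + 1) := by
        have := pow_add_mul_le_add_pow (a := r) (b := 1) (Nat.zero_le _) (by omega) (r + 1)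
        simpa using this
      have h2 : r ^ r ≤ r ^ (r + 1) := Nat.pow_le_pow_right hr (Nat.le_succ r)
      linarith
    calc (r + 1 + 1) * (r + 1).factorial ≤ (r + 2) * (2 * r ^ r) := by gcongr
      _ = 2 * ((r + 2) * r ^ r) := by ring
      _ ≤ _ := by gcongr

open Finset in
theorem two_mul_card_le_of_antisymm {τ : Type*} [Fintype τ] (s : Finset (τ × τ))
    (hs : ∀ a b, (a, b) ∈ s → (b, a) ∉ s) : 2 * #s ≤ Fintype.card τ ^ 2 := by
  classical
  have hd : Disjoint s (s.map (Equiv.prodComm τ τ).toEmbedding) := by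
    rw [Finset.disjoint_left]
    rintro ⟨a, b⟩ h h'
    exact hs a b h (by simpa using h')
  have := Finset.card_le_univ (s ∪ s.map (Equiv.prodComm τ τ).toEmbedding)
  rw [Finset.card_union_of_disjoint hd, Finset.card_map, Fintype.card_prod] at this
  rw [sq]; omega

/-- The decomposition of a Graver element into differences of unit vectors has few parts. -/
theorem exists_flow_of_mem_graverBasis {r t n : ℕ} (D : Matrix (Fin r) (Fin t) ℤ)
    (g : Fin n × Fin t → ℤ) (hg : g ∈ GraverBasis (nFold n D (onesRow t))) :
    ∃ f : Fin n → Fin t → Fin t → ℕ, (∀ i a, g (i, a) = netFlow (f i) a) ∧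
      ∑ i, ∑ a, ∑ b, f i a b ≤ t ^ 2 * (2 * r * (1 + matInfNorm D)) ^ r := by
  classical
  obtain ⟨hg0, hgk, hgmin⟩ := hg
  have hbrick := ((nFold_onesRow_mulVec_eq_zero_iff D g).mp hgk).2
  choose f hgf hf using fun i => exists_transport (fun a => g (i, a)) (hbrick i)
  have hgf : ∀ i a, g (i, a) = netFlow (f i) a := hgf
  have hgf' : g = fun q => netFlow (f q.1) q.2 := funext fun q => hgf q.1 q.2
  simp only [hgf] at hf
  refine ⟨f, hgf, ?_⟩
  let w : Fin t × Fin t → ℕ := fun p => ∑ i, f i p.1 p.2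
  have hswap : ∀ f' : Fin n → Fin t → Fin t → ℕ,
      ∑ i, ∑ a, ∑ b, f' i a b = ∑ p : Fin t × Fin t, ∑ i, f' i p.1 p.2 := fun f' => by
    rw [Finset.sum_comm (s := (Finset.univ : Finset (Fin t × Fin t)))]
    simp only [Fintype.sum_prod_type]
  have habs : ∀ f' : Fin n → Fin t → Fin t → ℕ, (∀ i a b, f' i a b ≤ f i a b) →
      ∑ i, ∑ a, |netFlow (f' i) a| = 2 * ((∑ p : Fin t × Fin t, ∑ i, f' i p.1 p.2 : ℕ) : ℤ) := by
    intro f' hle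
    have : ∀ i, ∑ a, |netFlow (f' i) a| = 2 * ∑ a, ∑ b, (f' i a b : ℤ) := by
      intro i
      simp only [fun a => (netFlow_conforms _ _ (hf i) (hle i) a).2.2, Finset.sum_add_distrib]
      rw [Finset.sum_comm (f := fun a b => (f' i b a : ℤ))]
      ring
    simp only [this, ← Finset.mul_sum, ← hswap f']
    push_cast
    rfl
  have hwsum : ∑ i, ∑ a, ∑ b, f i a b = ∑ p, w p := hswap f
  have hw0 : w ≠ 0 := by
    intro h
    have h1 := habs f fun _ _ _ => le_rfl
    have h2 : ∑ p : Fin t × Fin t, ∑ i, f i p.1 p.2 = 0 :=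
      Finset.sum_eq_zero fun p _ => congrFun h p
    rw [h2, Nat.cast_zero, mul_zero,
      Finset.sum_eq_zero_iff_of_nonneg fun i _ => Finset.sum_nonneg fun a _ => abs_nonneg _] at h1
    refine hg0 (funext fun q => ?_)
    have h3 := (Finset.sum_eq_zero_iff_of_nonneg fun a _ => abs_nonneg _).mp
      (h1 q.1 (Finset.mem_univ _)) q.2 (Finset.mem_univ _)
    rw [hgf']
    exact abs_eq_zero.mp h3
  have hwk : (colDiff D).mulVec (fun p => (w p : ℤ)) = 0 :=
    (nFold_mulVec_netFlow_eq_zero_iff D f).mp (hgf' ▸ hgk)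
  have hwmin : ∀ u : Fin t × Fin t → ℕ, u ≠ 0 → u ≤ w →
      (colDiff D).mulVec (fun p => (u p : ℤ)) = 0 → ∑ p, u p = ∑ p, w p := by
    intro u hu0 huw huk
    choose F hFle hFsum using fun p => exists_le_sum_eq (fun i => f i p.1 p.2) (u p) (huw p)
    let f' : Fin n → Fin t → Fin t → ℕ := fun i a b => F (a, b) i
    have hle : ∀ i a b, f' i a b ≤ f i a b := fun i a b => hFle (a, b) i
    have hsum : ∀ p : Fin t × Fin t, ∑ i, f' i p.1 p.2 = u p := fun p => hFsum p
    have hf' := habs f' hle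
    simp only [hsum] at hf'
    have heq : (fun q : Fin n × Fin t => netFlow (f' q.1) q.2) = g := by
      refine hgmin _ (fun h => hu0 ?_) ?_ ?_
      · have h1 : ∑ i, ∑ a, |netFlow (f' i) a| = 0 :=
          Finset.sum_eq_zero fun i _ => Finset.sum_eq_zero fun a _ =>
            abs_eq_zero.mpr (congrFun h (i, a))
        have h2 : ∑ p, u p = 0 := by omega
        exact funext fun p => Finset.sum_eq_zero_iff.mp h2 p (Finset.mem_univ _)
      · rw [nFold_mulVec_netFlow_eq_zero_iff]
        simpa only [hsum] using huk
      · rw [hgf']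
        exact ⟨fun q => (netFlow_conforms _ _ (hf q.1) (hle q.1) q.2).1,
          fun q => (netFlow_conforms _ _ (hf q.1) (hle q.1) q.2).2.1⟩
    have hgabs := habs f fun _ _ _ => le_rfl
    have : ∀ i a, netFlow (f' i) a = netFlow (f i) a := fun i a => by
      rw [← hgf, ← heq]
    simp only [this] at hf'
    have h3 : ((∑ p, u p : ℕ) : ℤ) = ((∑ p, w p : ℕ) : ℤ) := by
      simp only [w]; omega
    exact_mod_cast h3
  rw [hwsum]
  by_cases hcyc : ∃ a b, w (a, b) ≠ 0 ∧ w (b, a) ≠ 0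
  · obtain ⟨a, b, h1, h2⟩ := hcyc
    have hab : a ≠ b := by
      rintro rfl
      obtain ⟨i, -, hi⟩ := Finset.exists_ne_zero_of_sum_ne_zero h1
      have := hf i a a (Nat.pos_of_ne_zero hi)
      omega
    have hne : (a, b) ≠ (b, a) := fun h => hab (congrArg Prod.fst h)
    rw [← hwmin (Pi.single (a, b) 1 + Pi.single (b, a) 1) ?_ ?_ ?_]
    · simp only [Pi.add_apply, Finset.sum_add_distrib, Finset.sum_pi_single', Finset.mem_univ,
        if_true]
      have ht : 2 ≤ t := by
        have := a.2; have := b.2; have : a.1 ≠ b.1 := fun h => hab (Fin.ext h); omega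
      have hpos : 0 < (2 * r * (1 + matInfNorm D)) ^ r := by
        rcases Nat.eq_zero_or_pos r with rfl | hr
        · simp
        · positivity
      nlinarith
    · intro h
      have := congrFun h (a, b)
      simp [hne] at this
    · intro p
      by_cases h3 : p = (a, b)
      · subst h3; simpa [hne] using Nat.one_le_iff_ne_zero.mpr h1
      by_cases h4 : p = (b, a)
      · subst h4; simpa [hne.symm] using Nat.one_le_iff_ne_zero.mpr h2
      simp [h3, h4]
    · ext k
      simp [Matrix.mulVec, dotProduct, mul_add, Finset.sum_add_distrib, Pi.single_apply, colDiff]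
  · push Not at hcyc
    have hV : ∀ k p, (colDiff D k p).natAbs ≤ 2 * (1 + matInfNorm D) := by
      intro k p
      have h1 := natAbs_le_matInfNorm D k p.1
      have h2 := natAbs_le_matInfNorm D k p.2
      simp only [colDiff, Matrix.of_apply]
      omega
    have h1 := sum_le_of_minimal (colDiff D) (2 * (1 + matInfNorm D)) (by omega) hV w hw0 hwk hwmin
    have h2 := two_mul_card_le_of_antisymm (Finset.univ.filter fun p => w p ≠ 0)
      (by simpa using hcyc)
    rw [Fintype.card_fin] at h1 h2
    set S := (Finset.univ.filter fun p => w p ≠ 0).card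
    calc ∑ p, w p ≤ S * ((r + 1).factorial * (2 * (1 + matInfNorm D)) ^ r) := h1
      _ ≤ S * (2 * r ^ r * (2 * (1 + matInfNorm D)) ^ r) := by
          gcongr; exact factorial_succ_le_two_mul_pow r
      _ = 2 * S * (r * (2 * (1 + matInfNorm D))) ^ r := by rw [mul_pow r]; ring
      _ ≤ t ^ 2 * (r * (2 * (1 + matInfNorm D))) ^ r := by gcongr
      _ = _ := by congr 2; ring

/-- Combinatorial `n`-fold IP (`E = (D; 1ᵀ)`), with `Δ = 1 + ‖D‖_∞` and
`g(E) := t²(2rΔ)^r`: every Graver basis element `g` of `E^{(n)}` satisfies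
`‖g‖_∞ ≤ g(E)`, and every brick prefix sum of `g` is at most `g(E)` in
absolute value. -/
theorem comb_nfold_graver_entries_and_prefix_sums {r t n : ℕ} (hn : 1 ≤ n)
    (D : Matrix (Fin r) (Fin t) ℤ)
    (g : Fin n × Fin t → ℤ) (hg : g ∈ GraverBasis (nFold n D (onesRow t))) :
    (∀ q : Fin n × Fin t,
      (g q).natAbs ≤ t ^ 2 * (2 * r * (1 + matInfNorm D)) ^ r) ∧
    (∀ (i : Fin n) (j : Fin t),
      (∑ l ∈ Finset.univ.filter fun l : Fin t => l ≤ j, g (i, l)).natAbs ≤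
        t ^ 2 * (2 * r * (1 + matInfNorm D)) ^ r) := by
  obtain ⟨f, hgf, hf⟩ := exists_flow_of_mem_graverBasis D g hg
  have key : ∀ (i : Fin n) (s : Finset (Fin t)), (∑ l ∈ s, g (i, l)).natAbs ≤
      t ^ 2 * (2 * r * (1 + matInfNorm D)) ^ r := by
    intro i s
    simp only [hgf]
    exact ((natAbs_sum_netFlow_le (f i) s).trans
      (Finset.single_le_sum (f := fun i => ∑ a, ∑ b, f i a b) (fun _ _ => Nat.zero_le _)
        (Finset.mem_univ i))).trans hf
  exact ⟨fun q => by simpa using key q.1 {q.2}, fun i j => key i _⟩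
end
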